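/- From the position P8, the jump consisting of the single hop in the northeast (↗) direction — taking the ball from a2 over the contiguous line of chaps b3, c4, d5, e6, f7, g8, h9, i10 to the point j11 and removing those eight chaps — is Alfred's unique non-losing move: after this jump, Betty has no winning strategy from the resulting position, while after every other legal move of Alfred from P8, Betty has a winning strategy from the resulting position. -/

import Mathlib

/-!
Formalization of Philosophers' Phutball on an `m × n` board (`m` rows, `n` columns).
Points are pairs `(column, row)` of integers, with columns `1, …, n` (a, b, c, …)
and rows `1, …, m` (bottom to top).  Player `true` is Alfred (first player, aims
for the top row `m`); player `false` is Betty (aims for the bottom row `1`).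
-/

/-- A player: `true` is Alfred, `false` is Betty. -/
abbrev Player := Bool

/-- A Phutball position: the ball's point `(column, row)`, the finite set of
chaps, and the player whose turn it is. -/
structure PState where
  ball : ℤ × ℤ
  chaps : Finset (ℤ × ℤ)
  turn : Player
deriving DecidableEq

/-- The eight horizontal, vertical and diagonal directions. -/
def dirs : Finset (ℤ × ℤ) :=
  {(1, 0), (1, 1), (0, 1), (-1, 1), (-1, 0), (-1, -1), (0, -1), (1, -1)}

/-- The point reached from `b` after `i` steps in direction `d`. -/
def ray (b d : ℤ × ℤ) (i : ℤ) : ℤ × ℤ := (b.1 + i * d.1, b.2 + i * d.2)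

/-- A point is on the `m × n` board. -/
def OnBoard (m n : ℤ) (p : ℤ × ℤ) : Prop :=
  1 ≤ p.1 ∧ p.1 ≤ n ∧ 1 ≤ p.2 ∧ p.2 ≤ m

/-- A single hop on a board with `n` columns: the ball at `b` moves in one of the
eight directions `d` over a contiguous nonempty line of `k` chaps, landing on the
first point beyond them that carries no chap; the jumped-over chaps are removed.
The landing point must not lie onto or past the sidelines (outside columns
`1, …, n`), but it may lie past the top or bottom row. -/
def Hop (n : ℤ) (b : ℤ × ℤ) (c : Finset (ℤ × ℤ)) (b' : ℤ × ℤ) (c' : Finset (ℤ × ℤ)) : Prop :=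
  ∃ d ∈ dirs, ∃ k : ℕ, 1 ≤ k ∧
    (∀ i : ℕ, 1 ≤ i → i ≤ k → ray b d i ∈ c) ∧
    ray b d (k + 1) ∉ c ∧
    1 ≤ (ray b d (k + 1)).1 ∧ (ray b d (k + 1)).1 ≤ n ∧
    b' = ray b d (k + 1) ∧
    c' = c \ Finset.image (fun i : ℕ => ray b d i) (Finset.Icc 1 k)

/-- A jump is a nonempty sequence of hops (the player may stop after any hop,
and the removed chaps cannot be re-used by later hops of the same jump).  The
jump can continue after a hop only if the ball has not been carried past the top
or bottom row (which would end the game immediately). -/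
inductive Jump (m n : ℤ) : ℤ × ℤ → Finset (ℤ × ℤ) → ℤ × ℤ → Finset (ℤ × ℤ) → Prop
  | single {b c b' c'} : Hop n b c b' c' → Jump m n b c b' c'
  | cons {b c b₁ c₁ b' c'} : Hop n b c b₁ c₁ → 1 ≤ b₁.2 → b₁.2 ≤ m →
      Jump m n b₁ c₁ b' c' → Jump m n b c b' c'

/-- The winner, if any, of a position (evaluated between turns): Alfred wins if
the ball rests on the top row `m` or has been carried past it; Betty wins if the
ball rests on the bottom row `1` or has been carried past it. -/
def winner (m : ℤ) (s : PState) : Option Player :=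
  if m ≤ s.ball.2 then some true else if s.ball.2 ≤ 1 then some false else none

/-- A single legal move on the `m × n` board: the player to move either places a
chap on a vacant on-board point, or moves the ball by a jump; the turn passes to
the other player. -/
def MoveRel (m n : ℤ) (s t : PState) : Prop :=
  t.turn = !s.turn ∧
    ((∃ p, OnBoard m n p ∧ p ∉ s.chaps ∧ p ≠ s.ball ∧
        t.ball = s.ball ∧ t.chaps = insert p s.chaps) ∨
      Jump m n s.ball s.chaps t.ball t.chaps)

/-- An infinite record of play: while the game is not over and a legal move
exists, a legal move is made; otherwise the position is frozen forever. -/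
def IsPlay (m n : ℤ) (f : ℕ → PState) : Prop :=
  ∀ k,
    (winner m (f k) = none ∧ (∃ t, MoveRel m n (f k) t) ∧ MoveRel m n (f k) (f (k + 1))) ∨
    ((winner m (f k) ≠ none ∨ ¬ ∃ t, MoveRel m n (f k) t) ∧ f (k + 1) = f k)

/-- A strategy for player `p` that always proposes a legal move whenever the game
is not over, it is `p`'s turn, and some legal move exists. -/
def LegalStrategy (m n : ℤ) (p : Player) (σ : PState → PState) : Prop :=
  ∀ s, s.turn = p → winner m s = none → (∃ t, MoveRel m n s t) → MoveRel m n s (σ s)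

/-- The play `f` follows the strategy `σ` of player `p`. -/
def Follows (m n : ℤ) (p : Player) (σ : PState → PState) (f : ℕ → PState) : Prop :=
  ∀ k, (f k).turn = p → winner m (f k) = none → (∃ t, MoveRel m n (f k) t) →
    f (k + 1) = σ (f k)

/-- Player `p` has a winning strategy from `s₀` on the `m × n` board: a legal
strategy guaranteeing that, against every play of the opponent, `p` wins after
finitely many moves. -/
def WinsFrom (m n : ℤ) (p : Player) (s₀ : PState) : Prop :=
  ∃ σ, LegalStrategy m n p σ ∧
    ∀ f, IsPlay m n f → f 0 = s₀ → Follows m n p σ f → ∃ k, winner m (f k) = some p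

/-- Player `p` has a drawing strategy from `s₀` on the `m × n` board: a legal
strategy guaranteeing that the opponent never wins (play may continue forever). -/
def DrawsFrom (m n : ℤ) (p : Player) (s₀ : PState) : Prop :=
  ∃ σ, LegalStrategy m n p σ ∧
    ∀ f, IsPlay m n f → f 0 = s₀ → Follows m n p σ f → ∀ k, winner m (f k) ≠ some (!p)

/-- A position is drawn if both players have drawing strategies from it. -/
def Drawn (m n : ℤ) (s : PState) : Prop :=
  DrawsFrom m n true s ∧ DrawsFrom m n false s

/-- The 24 chaps of the position `P0` on the 12 × 10 board:
c1, c2, c5, c7, c9, c10, c11, c12, d6, e4, e11, e12, f1, f2, f9, g7,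
h1, h2, h3, h4, h6, h8, h11, h12. -/
def P0chaps : Finset (ℤ × ℤ) :=
  {(3, 1), (3, 2), (3, 5), (3, 7), (3, 9), (3, 10), (3, 11), (3, 12), (4, 6), (5, 4), (5, 11), (5, 12), (6, 1), (6, 2), (6, 9), (7, 7), (8, 1), (8, 2), (8, 3), (8, 4), (8, 6), (8, 8), (8, 11), (8, 12)}

/-- The position `P0`: ball at a2 = (1, 2), the 24 chaps above, Alfred to move. -/
def P0 : PState := ⟨(1, 2), P0chaps, true⟩

/-- The position `P8`: `P0` with additional chaps at b3, c4, d5, e6, f7, g8, h9,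
i10, with Alfred to move. -/
def P8 : PState := ⟨(1, 2), P0chaps ∪ {(2, 3), (3, 4), (4, 5), (5, 6), (6, 7), (7, 8), (8, 9), (9, 10)}, true⟩

/-- The result of Alfred's northeast jump from `P8`: the single hop ↗ from
a2 over the contiguous line of chaps b3, c4, d5, e6, f7, g8, h9, i10 to j11,
removing those eight chaps; the remaining chaps are exactly those of `P0`, and
Betty is to move. -/
def P8jump : PState := ⟨(10, 11), P0chaps, false⟩

/-! ### The game as a reachability game -/

/-- Player `p` can force a win from `s` within `k` further moves. -/
def WinsIn (m n : ℤ) (p : Player) : ℕ → PState → Prop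
  | 0, s => winner m s = some p
  | k + 1, s => WinsIn m n p k s ∨
      winner m s = none ∧ (∃ t, MoveRel m n s t) ∧
        if s.turn = p then ∃ t, MoveRel m n s t ∧ WinsIn m n p k t
        else ∀ t, MoveRel m n s t → WinsIn m n p k t

lemma WinsIn.mono {m n : ℤ} {p : Player} {k l : ℕ} (h : k ≤ l) {s : PState}
    (hs : WinsIn m n p k s) : WinsIn m n p l s := by
  induction h with
  | refl => exact hs
  | step _ ih => exact Or.inl ih

lemma WinsIn.of_winner {m n : ℤ} {p : Player} {s : PState} (h : winner m s = some p) (k : ℕ) :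
    WinsIn m n p k s :=
  WinsIn.mono (Nat.zero_le k) h

open Classical in
/-- The positional strategy of `p` that moves to a position won as fast as possible. -/
noncomputable def greedy (m n : ℤ) (p : Player) (s : PState) : PState :=
  if h : ∃ k t, MoveRel m n s t ∧ WinsIn m n p k t then (Nat.find_spec h).choose
  else if h : ∃ t, MoveRel m n s t then h.choose else s

open Classical in
lemma greedy_legal (m n : ℤ) (p : Player) : LegalStrategy m n p (greedy m n p) := by
  intro s _ _ hs
  unfold greedy
  split_ifs with h
  · exact (Nat.find_spec h).choose_spec.1
  · exact hs.choose_spec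

open Classical in
lemma greedy_winsIn {m n : ℤ} {p : Player} {s t : PState} {k : ℕ} (hm : MoveRel m n s t)
    (ht : WinsIn m n p k t) : WinsIn m n p k (greedy m n p s) := by
  have h : ∃ k t, MoveRel m n s t ∧ WinsIn m n p k t := ⟨k, t, hm, ht⟩
  unfold greedy
  rw [dif_pos h]
  have h2 := (Nat.find_spec h).choose_spec.2
  refine WinsIn.mono ?_ h2
  exact Nat.find_min' h ⟨t, hm, ht⟩

lemma WinsIn.winsFrom {m n : ℤ} {p : Player} {k : ℕ} {s : PState} (hs : WinsIn m n p k s) :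
    WinsFrom m n p s := by
  refine ⟨greedy m n p, greedy_legal m n p, fun f hf h0 hfol => ?_⟩
  suffices H : ∀ k j, WinsIn m n p k (f j) → ∃ i, winner m (f i) = some p from
    H k 0 (h0 ▸ hs)
  intro k
  induction k with
  | zero => exact fun j hj => ⟨j, hj⟩
  | succ k ih =>
    rintro j (hj | ⟨hw, hex, hj⟩)
    · exact ih j hj
    · refine ih (j + 1) ?_
      split_ifs at hj with hturn
      · obtain ⟨t, hm, ht⟩ := hj
        rw [hfol j hturn hw hex]
        exact greedy_winsIn hm ht
      · rcases hf j with ⟨_, _, hm⟩ | ⟨h | h, _⟩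
        · exact hj _ hm
        · exact absurd hw h
        · exact absurd hex h

/-- A set of positions not won by `p` that the opponent of `p` can never be forced to leave
contains no position from which `p` has a winning strategy. -/
lemma not_winsFrom_of_invariant {m n : ℤ} {p : Player} (D : Set PState)
    (hwin : ∀ s ∈ D, winner m s ≠ some p)
    (hown : ∀ s ∈ D, winner m s = none → s.turn = p → ∀ t, MoveRel m n s t → t ∈ D)
    (hopp : ∀ s ∈ D, winner m s = none → s.turn ≠ p → (∃ t, MoveRel m n s t) →
      ∃ t ∈ D, MoveRel m n s t)
    {s : PState} (hs : s ∈ D) : ¬ WinsFrom m n p s := by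
  classical
  rintro ⟨σ, hleg, hσ⟩
  have step : ∀ s : D, ∃ t : D,
      ((winner m s.1 = none ∧ (∃ t, MoveRel m n s.1 t) ∧ MoveRel m n s.1 t.1) ∨
        ((winner m s.1 ≠ none ∨ ¬ ∃ t, MoveRel m n s.1 t) ∧ t.1 = s.1)) ∧
      (s.1.turn = p → winner m s.1 = none → (∃ t, MoveRel m n s.1 t) → t.1 = σ s.1) := by
    rintro ⟨s, hs⟩
    by_cases hw : winner m s = none
    · by_cases hex : ∃ t, MoveRel m n s t
      · by_cases hturn : s.turn = p
        · have hm := hleg s hturn hw hex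
          exact ⟨⟨σ s, hown s hs hw hturn _ hm⟩, Or.inl ⟨hw, hex, hm⟩, fun _ _ _ => rfl⟩
        · obtain ⟨t, ht, hm⟩ := hopp s hs hw hturn hex
          exact ⟨⟨t, ht⟩, Or.inl ⟨hw, hex, hm⟩, fun h => absurd h hturn⟩
      · exact ⟨⟨s, hs⟩, Or.inr ⟨Or.inr hex, rfl⟩, fun _ _ h => absurd h hex⟩
    · exact ⟨⟨s, hs⟩, Or.inr ⟨Or.inl hw, rfl⟩, fun _ h => absurd h hw⟩
  choose g hg using step
  let f : ℕ → D := fun k => Nat.rec ⟨s, hs⟩ (fun _ x => g x) k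
  obtain ⟨k, hk⟩ := hσ (fun k => (f k).1) (fun k => (hg (f k)).1) rfl (fun k => (hg (f k)).2)
  exact hwin _ (f k).2 hk

/-! ### The half-turn of the `12 × 10` board -/

/-- The half-turn of the board, on points. -/
def turnPoint (p : ℤ × ℤ) : ℤ × ℤ := (11 - p.1, 13 - p.2)

/-- The half-turn of the board together with the exchange of the two players. -/
def turnState (s : PState) : PState := ⟨turnPoint s.ball, s.chaps.image turnPoint, !s.turn⟩

lemma turnPoint_involutive : Function.Involutive turnPoint := by
  rintro ⟨x, y⟩
  simp [turnPoint]

lemma turnState_involutive : Function.Involutive turnState := by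
  rintro ⟨b, c, p⟩
  simp [turnState, Finset.image_image, turnPoint_involutive.comp_self, turnPoint_involutive b]

lemma turnPoint_mem_image {p : ℤ × ℤ} {c : Finset (ℤ × ℤ)} :
    turnPoint p ∈ c.image turnPoint ↔ p ∈ c := by
  simp [turnPoint_involutive.injective.eq_iff]

lemma turnPoint_ray (b d : ℤ × ℤ) (i : ℤ) : ray (turnPoint b) (-d) i = turnPoint (ray b d i) := by
  ext <;> simp [ray, turnPoint] <;> ring

lemma Hop.turn {b b' : ℤ × ℤ} {c c' : Finset (ℤ × ℤ)} (h : Hop 10 b c b' c') :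
    Hop 10 (turnPoint b) (c.image turnPoint) (turnPoint b') (c'.image turnPoint) := by
  obtain ⟨d, hd, k, hk, hline, hland, h1, h10, rfl, rfl⟩ := h
  have hd' : -d ∈ dirs := (by decide : ∀ d ∈ dirs, -d ∈ dirs) d hd
  refine ⟨-d, hd', k, hk, ?_, ?_, ?_, ?_, ?_, ?_⟩ <;> simp only [turnPoint_ray]
  · exact fun i hi hik => turnPoint_mem_image.2 (hline i hi hik)
  · exact fun h => hland (turnPoint_mem_image.1 h)
  · simp only [turnPoint]; omega
  · simp only [turnPoint]; omega
  · rw [Finset.image_sdiff _ _ turnPoint_involutive.injective, Finset.image_image]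
    rfl

lemma Jump.turn {b b' : ℤ × ℤ} {c c' : Finset (ℤ × ℤ)} (h : Jump 12 10 b c b' c') :
    Jump 12 10 (turnPoint b) (c.image turnPoint) (turnPoint b') (c'.image turnPoint) := by
  induction h with
  | single h => exact .single h.turn
  | cons h h1 h12 _ ih =>
    refine .cons h.turn ?_ ?_ ih <;> simp only [turnPoint] <;> omega

lemma MoveRel.turn {s t : PState} (h : MoveRel 12 10 s t) :
    MoveRel 12 10 (turnState s) (turnState t) := by
  obtain ⟨ht, ⟨p, hp, hpc, hpb, hb, hc⟩ | h⟩ := h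
  · refine ⟨by simp [turnState, ht], Or.inl ⟨turnPoint p, ?_, ?_, ?_, ?_, ?_⟩⟩
    · simp only [OnBoard, turnPoint] at hp ⊢
      omega
    · exact fun h => hpc (turnPoint_mem_image.1 h)
    · exact fun h => hpb (turnPoint_involutive.injective h)
    · simp [turnState, hb]
    · simp [turnState, hc, Finset.image_insert]
  · exact ⟨by simp [turnState, ht], Or.inr h.turn⟩

lemma moveRel_turn_iff {s t : PState} :
    MoveRel 12 10 (turnState s) t ↔ MoveRel 12 10 s (turnState t) :=
  ⟨fun h => by simpa [turnState_involutive s] using h.turn,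
    fun h => by simpa [turnState_involutive t] using h.turn⟩

lemma winner_turn (s : PState) : winner 12 (turnState s) = (winner 12 s).map (!·) := by
  have h1 : (12 : ℤ) ≤ 13 - s.ball.2 ↔ s.ball.2 ≤ 1 := by omega
  have h2 : 13 - s.ball.2 ≤ 1 ↔ 12 ≤ s.ball.2 := by omega
  simp only [winner, turnState, turnPoint, h1, h2]
  split_ifs <;> first | rfl | omega

lemma WinsIn.turn {p : Player} {k : ℕ} {s : PState} (h : WinsIn 12 10 p k s) :
    WinsIn 12 10 (!p) k (turnState s) := by
  induction k generalizing s with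
  | zero =>
    have h : winner 12 s = some p := h
    simp [WinsIn, winner_turn, h]
  | succ k ih =>
    rcases h with h | ⟨hw, ⟨t, ht⟩, h⟩
    · exact Or.inl (ih h)
    · refine Or.inr ⟨by simp [winner_turn, hw], ⟨_, ht.turn⟩, ?_⟩
      by_cases hp : s.turn = p
      · rw [if_pos hp] at h
        obtain ⟨t, ht, htk⟩ := h
        rw [if_pos (by simp [turnState, hp])]
        exact ⟨_, ht.turn, ih htk⟩
      · rw [if_neg hp] at h
        rw [if_neg (by simpa [turnState] using hp)]
        intro t ht
        have := ih (h _ (moveRel_turn_iff.1 ht))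
        rwa [turnState_involutive t] at this

/-! ### Codes of points, and sets of points as bit masks -/

/-- The point with a given code; the code of column `x`, row `y` is `12 * y + x`. -/
def point (i : ℕ) : ℤ × ℤ := ((i % 12 : ℕ), (i / 12 : ℕ))

/-- The code of a point with column in `0, …, 11` and nonnegative row. -/
def code (p : ℤ × ℤ) : ℕ := 12 * p.2.toNat + p.1.toNat

lemma code_point (i : ℕ) : code (point i) = i := by
  simp only [code, point, Int.toNat_natCast]
  omega

lemma point_code {p : ℤ × ℤ} (hp : OnBoard 12 10 p) : point (code p) = p := by
  obtain ⟨h1, h2, h3, h4⟩ := hp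
  ext <;> simp only [code, point] <;> omega

/-- The mask of a single code. -/
def bit (i : ℕ) : ℕ := 2 ^ i

lemma testBit_bit (i j : ℕ) : (bit i).testBit j = decide (i = j) := Nat.testBit_two_pow

/-- The difference of two masks. -/
def minus (A B : ℕ) : ℕ := A ^^^ (A &&& B)

lemma testBit_minus (A B i : ℕ) : (minus A B).testBit i = (A.testBit i && !B.testBit i) := by
  simp only [minus, Nat.testBit_xor, Nat.testBit_and]
  cases A.testBit i <;> cases B.testBit i <;> rfl

/-- Whether a code belongs to a point of the board. -/
def onBoard (i : ℕ) : Bool := 1 ≤ i % 12 && i % 12 ≤ 10 && 12 ≤ i && i < 156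

lemma onBoard_iff {i : ℕ} : onBoard i = true ↔ OnBoard 12 10 (point i) := by
  simp only [onBoard, OnBoard, point, Bool.and_eq_true, decide_eq_true_eq]
  omega

/-- The codes of all points of the board. -/
def boardCodes : List ℕ := (List.range 168).filter onBoard

lemma code_mem_boardCodes {p : ℤ × ℤ} (hp : OnBoard 12 10 p) : code p ∈ boardCodes := by
  refine List.mem_filter.2 ⟨List.mem_range.2 ?_, onBoard_iff.2 (by rwa [point_code hp])⟩
  obtain ⟨h1, h2, h3, h4⟩ := hp
  simp only [code]
  omega

/-- Codes of the eight directions; `o` stands for the direction `point o - (1, 1)`. -/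
def offsets : List ℕ := [14, 26, 25, 24, 12, 0, 1, 2]

/-- The direction with a given code. -/
def direction (o : ℕ) : ℤ × ℤ := ((point o).1 - 1, (point o).2 - 1)

lemma direction_mem {o : ℕ} (ho : o ∈ offsets) : direction o ∈ dirs :=
  (by decide : ∀ o ∈ offsets, direction o ∈ dirs) o ho

lemma exists_offset {d : ℤ × ℤ} (hd : d ∈ dirs) : ∃ o ∈ offsets, direction o = d :=
  (by decide : ∀ d ∈ dirs, ∃ o ∈ offsets, direction o = d) d hd

lemma point_step {o i : ℕ} (ho : o ∈ offsets) (hi : OnBoard 12 10 (point i)) :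
    point (i + o - 13) = ray (point i) (direction o) 1 := by
  obtain ⟨h1, h2, h3, h4⟩ := hi
  simp only [point] at h1 h2 h3 h4
  simp only [offsets, List.mem_cons, List.not_mem_nil, or_false] at ho
  rcases ho with rfl | rfl | rfl | rfl | rfl | rfl | rfl | rfl <;>
    ext <;> simp only [point, ray, direction] <;> omega

/-- The line of chaps of `X` starting at `i` in direction `o`, and the first point beyond it. -/
def slide (X o : ℕ) : ℕ → ℕ → ℕ × ℕ
  | 0, i => (0, i)
  | fuel + 1, i =>
    if X.testBit i then ((slide X o fuel (i + o - 13)).1 ||| bit i,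
      (slide X o fuel (i + o - 13)).2)
    else (0, i)

/-- The knowledge about a position with ball `b` and chaps `C` on which a search relies:
the points of `X` carry chaps and those of `Z` do not. -/
structure Agrees (b X Z : ℕ) (C : Finset (ℤ × ℤ)) : Prop where
  board : ∀ p ∈ C, OnBoard 12 10 p
  ball : OnBoard 12 10 (point b)
  ball_not_mem : point b ∉ C
  mem : ∀ i, X.testBit i = true → point i ∈ C
  not_mem : ∀ i, Z.testBit i = true → point i ∉ C

/-- The chaps left after those in the mask `L` have been removed. -/
def remove (C : Finset (ℤ × ℤ)) (L : ℕ) : Finset (ℤ × ℤ) :=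
  C.filter fun p => L.testBit (code p) = false

lemma ray_add (b d : ℤ × ℤ) (i j : ℤ) : ray (ray b d i) d j = ray b d (i + j) := by
  ext <;> simp [ray] <;> ring

lemma ray_zero (b d : ℤ × ℤ) : ray b d 0 = b := by simp [ray]

lemma slide_spec {X o : ℕ} {C : Finset (ℤ × ℤ)} (hC : ∀ p ∈ C, OnBoard 12 10 p)
    (hX : ∀ i, X.testBit i = true → point i ∈ C) (ho : o ∈ offsets) (fuel i : ℕ) :
    ∃ k : ℕ, point (slide X o fuel i).2 = ray (point i) (direction o) k ∧
      (∀ j : ℕ, j < k → ray (point i) (direction o) j ∈ C) ∧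
      (∀ p ∈ C, (slide X o fuel i).1.testBit (code p) = true ↔
        ∃ j : ℕ, j < k ∧ ray (point i) (direction o) j = p) ∧
      ((slide X o fuel i).1 = 0 ↔ k = 0) := by
  induction fuel generalizing i with
  | zero => exact ⟨0, by simp [slide, ray_zero]⟩
  | succ fuel ih =>
    by_cases hi : X.testBit i = true
    · obtain ⟨k, h1, h2, h3, -⟩ := ih (i + o - 13)
      have hiC := hX i hi
      rw [point_step ho (hC _ hiC)] at h1 h2 h3
      simp only [ray_add] at h1 h2 h3
      simp only [slide, hi, if_true]
      refine ⟨k + 1, ?_, ?_, ?_, ?_⟩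
      · rw [h1]; push_cast; rw [add_comm]
      · rintro (_ | j) hj
        · simpa [ray_zero] using hiC
        · have := h2 j (by omega)
          push_cast
          rwa [add_comm]
      · intro p hp
        rw [Nat.testBit_or, Bool.or_eq_true, h3 p hp, testBit_bit, decide_eq_true_eq]
        constructor
        · rintro (⟨j, hj, rfl⟩ | rfl)
          · exact ⟨j + 1, by omega, by push_cast; rw [add_comm]⟩
          · exact ⟨0, by omega, by simp [ray_zero, point_code (hC p hp)]⟩
        · rintro ⟨_ | j, hj, rfl⟩
          · exact Or.inr (by simp [ray_zero, code_point])
          · exact Or.inl ⟨j, by omega, by push_cast; rw [add_comm]⟩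
      · refine iff_of_false (fun h => ?_) (by omega)
        have := congrArg (Nat.testBit · i) h
        simp [Nat.testBit_or, testBit_bit] at this
    · refine ⟨0, ?_⟩
      simp only [slide, hi]
      simp [ray_zero]

/-- The line of chaps next to the ball in direction `o`, and the landing point of the hop. -/
def hopData (b X o : ℕ) : ℕ × ℕ := slide X o 12 (b + o - 13)

section
variable {b X Z o : ℕ} {C : Finset (ℤ × ℤ)}

lemma hopData_spec (h : Agrees b X Z C) (ho : o ∈ offsets) :
    ∃ k : ℕ, point (hopData b X o).2 = ray (point b) (direction o) (k + 1) ∧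
      (∀ j : ℕ, 1 ≤ j → j ≤ k → ray (point b) (direction o) j ∈ C) ∧
      C \ Finset.image (fun i : ℕ => ray (point b) (direction o) i) (Finset.Icc 1 k) =
        remove C (hopData b X o).1 ∧
      ((hopData b X o).1 = 0 ↔ k = 0) := by
  obtain ⟨k, h1, h2, h3, h4⟩ := slide_spec h.board h.mem ho 12 (b + o - 13)
  rw [point_step ho h.ball] at h1 h2 h3
  simp only [ray_add] at h1 h2 h3
  refine ⟨k, by rw [hopData, h1, add_comm], ?_, ?_, h4⟩
  · rintro (_ | j) hj hjk
    · omega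
    · have := h2 j (by omega)
      push_cast
      rwa [add_comm]
  · ext p
    simp only [remove, Finset.mem_sdiff, Finset.mem_filter, Finset.mem_image, Finset.mem_Icc]
    refine and_congr_right fun hp => ?_
    rw [← Bool.not_eq_true, hopData, h3 p hp, not_iff_not]
    constructor
    · rintro ⟨_ | j, hj, rfl⟩
      · omega
      · exact ⟨j, by omega, by push_cast; rw [add_comm]⟩
    · rintro ⟨j, hj, rfl⟩
      exact ⟨j + 1, by omega, by push_cast; rw [add_comm]⟩

/-- The hop in direction `o` exists when the line is nonempty and the landing column legal. -/
lemma hop_of_hopData (h : Agrees b X Z C) (ho : o ∈ offsets)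
    (hland : point (hopData b X o).2 ∉ C) (hL : (hopData b X o).1 ≠ 0)
    (h1 : 1 ≤ (hopData b X o).2 % 12) (h10 : (hopData b X o).2 % 12 ≤ 10) :
    Hop 10 (point b) C (point (hopData b X o).2) (remove C (hopData b X o).1) := by
  obtain ⟨k, hk, hline, hrem, hk0⟩ := hopData_spec h ho
  refine ⟨direction o, direction_mem ho, k, by omega, hline, hk ▸ hland, ?_, ?_, hk, hrem.symm⟩ <;>
    rw [← hk] <;> simp only [point] <;> omega

/-- The data of any hop is found by `hopData` for its direction. -/
lemma hopData_of_hop (h : Agrees b X Z C)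
    (hland : ∀ o ∈ offsets, point (hopData b X o).2 ∉ C) {b' : ℤ × ℤ} {C' : Finset (ℤ × ℤ)}
    (hop : Hop 10 (point b) C b' C') :
    ∃ o ∈ offsets, (hopData b X o).1 ≠ 0 ∧ 1 ≤ (hopData b X o).2 % 12 ∧
      (hopData b X o).2 % 12 ≤ 10 ∧ b' = point (hopData b X o).2 ∧
      C' = remove C (hopData b X o).1 := by
  obtain ⟨d, hd, k, hk, hline, hfree, h1, h10, rfl, rfl⟩ := hop
  obtain ⟨o, ho, rfl⟩ := exists_offset hd
  obtain ⟨l, hl, hlline, hrem, hl0⟩ := hopData_spec h ho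
  obtain rfl : k = l := by
    rcases lt_trichotomy k l with hkl | hkl | hkl
    · exact absurd (by simpa using hlline (k + 1) (by omega) (by omega)) hfree
    · exact hkl
    · refine absurd ?_ (hland o ho)
      rw [hl]
      simpa using hline (l + 1) (by omega) (by omega)
  refine ⟨o, ho, by omega, ?_, ?_, hl.symm, hrem⟩
  · rw [← hl] at h1; simp only [point] at h1; omega
  · rw [← hl] at h10; simp only [point] at h10; omega

/-- What is known after a hop. -/
lemma Agrees.hop {L l z : ℕ} (h : Agrees b X Z C) (hl : OnBoard 12 10 (point l))
    (hlC : point l ∉ C) (hz : ∀ i, (minus z L).testBit i = true → point i ∉ C) :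
    Agrees l (minus X L) z (remove C L) where
  board p hp := h.board p (Finset.mem_filter.1 hp).1
  ball := hl
  ball_not_mem hp := hlC (Finset.mem_filter.1 hp).1
  mem i hi := by
    simp only [testBit_minus, Bool.and_eq_true, Bool.not_eq_true'] at hi
    exact Finset.mem_filter.2 ⟨h.mem i hi.1, by rw [code_point]; exact hi.2⟩
  not_mem i hi hp := by
    obtain ⟨hp, hL⟩ := Finset.mem_filter.1 hp
    rw [code_point] at hL
    exact hz i (by simp [testBit_minus, hi, hL]) hp

/-- What is known after a placement. -/
lemma Agrees.place {q z : ℕ} (h : Agrees b X Z C) (hq : OnBoard 12 10 (point q)) (hqb : q ≠ b)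
    (hzq : z.testBit q = false) (hz : ∀ i, z.testBit i = true → point i ∉ C) :
    Agrees b (X ||| bit q) z (insert (point q) C) where
  board p hp := by
    rcases Finset.mem_insert.1 hp with rfl | hp
    exacts [hq, h.board p hp]
  ball := h.ball
  ball_not_mem hp := by
    rcases Finset.mem_insert.1 hp with hp | hp
    · exact hqb (by rw [← code_point q, ← hp, code_point])
    · exact h.ball_not_mem hp
  mem i hi := by
    rw [Nat.testBit_or, testBit_bit, Bool.or_eq_true, decide_eq_true_eq] at hi
    rcases hi with hi | rfl
    exacts [Finset.mem_insert_of_mem (h.mem i hi), Finset.mem_insert_self _ _]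
  not_mem i hi hp := by
    rcases Finset.mem_insert.1 hp with hp | hp
    · rw [← code_point i, hp, code_point, hzq] at hi
      exact absurd hi (by simp)
    · exact hz i hi hp

lemma Agrees.forget {Z' : ℕ} (h : Agrees b X Z C)
    (hZ : ∀ i, Z'.testBit i = true → point i ∉ C) : Agrees b X Z' C :=
  ⟨h.board, h.ball, h.ball_not_mem, h.mem, hZ⟩

end

/-! ### Certified search

A search takes a ball `b` and a mask `X` of chaps, and on success returns a mask `Z` such that
its conclusion holds for every position with ball `b` in which the points of `X` carry chaps and
those of `Z` do not. -/

/-- Success of the search `ev` establishes `P`, for positions with player `p` to move. -/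
def Sound (p : Player) (P : PState → Prop) (ev : ℕ → ℕ → Option ℕ) : Prop :=
  ∀ b X Z C, ev b X = some Z → Agrees b X Z C → P ⟨point b, C, p⟩

lemma Sound.imp {p : Player} {P Q : PState → Prop} {ev : ℕ → ℕ → Option ℕ} (h : Sound p P ev)
    (hPQ : ∀ s, P s → Q s) : Sound p Q ev :=
  fun b X Z C he hA => hPQ _ (h b X Z C he hA)

lemma sound_none (p : Player) (P : PState → Prop) : Sound p P fun _ _ => none :=
  fun _ _ _ _ h => by simp at h

/-- The union of the masks found by all of the searches in a list. -/
def gather (g : ℕ → Option ℕ) : List ℕ → Option ℕ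
  | [] => some 0
  | a :: l =>
    match g a, gather g l with
    | some x, some y => some (x ||| y)
    | _, _ => none

lemma gather_spec {g : ℕ → Option ℕ} {l : List ℕ} {z : ℕ} (h : gather g l = some z) {a : ℕ}
    (ha : a ∈ l) : ∃ x, g a = some x ∧ ∀ i, x.testBit i = true → z.testBit i = true := by
  induction l generalizing z with
  | nil => simp at ha
  | cons c l ih =>
    unfold gather at h
    split at h
    · rename_i x y hx hy
      obtain rfl := Option.some.inj h
      rcases List.mem_cons.1 ha with rfl | ha
      · exact ⟨x, hx, fun i hi => by simp [Nat.testBit_or, hi]⟩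
      · obtain ⟨w, hw, hwz⟩ := ih hy ha
        exact ⟨w, hw, fun i hi => by simp [Nat.testBit_or, hwz i hi]⟩
    · simp at h

/-- Checks with `ev` all positions Alfred can reach by a jump. -/
def jumpZone (ev : ℕ → ℕ → Option ℕ) : ℕ → ℕ → ℕ → Option ℕ
  | 0, _, _ => none
  | fuel + 1, b, X => gather (fun o =>
      if (hopData b X o).1 = 0 ∨ (hopData b X o).2 % 12 = 0 ∨ 10 < (hopData b X o).2 % 12 ∨
        (hopData b X o).2 < 12 then some (bit (hopData b X o).2)
      else if 144 ≤ (hopData b X o).2 then none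
      else
        match if (hopData b X o).2 < 24 then some 0
            else ev (hopData b X o).2 (minus X (hopData b X o).1),
          jumpZone ev fuel (hopData b X o).2 (minus X (hopData b X o).1) with
        | some z, some w => some (bit (hopData b X o).2 ||| minus (z ||| w) (hopData b X o).1)
        | _, _ => none) offsets

/-- The search checks Alfred's placements and jumps.  A placement outside the mask found by `ev₀`
when Alfred passes is refuted by the same reply as the pass; the others are checked by `ev`. -/
def alfred (ev₀ ev : ℕ → ℕ → Option ℕ) (b X : ℕ) : Option ℕ :=
  if 24 ≤ b ∧ b < 144 then
    match ev₀ b X, jumpZone ev 20 b X with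
    | some z₀, some zj =>
      match gather (fun i =>
          if z₀.testBit i = true ∧ i ≠ b then
            match ev b (X ||| bit i) with
            | some y => if y.testBit i then none else some y
            | none => none
          else some 0) boardCodes with
      | some zp =>
        if (boardCodes.any fun i => (z₀ ||| zj ||| zp).testBit i && !(i == b)) then
          some (z₀ ||| zj ||| zp)
        else none
      | none => none
    | _, _ => none
  else none

/-- Follows a jump of Betty given by its directions, and applies `ev` to the outcome. -/
def follow (ev : ℕ → ℕ → Option ℕ) : List ℕ → ℕ → ℕ → Option ℕ
  | [], _, _ => none
  | o :: path, b, X =>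
    if o ∈ offsets ∧ (hopData b X o).1 ≠ 0 ∧ 1 ≤ (hopData b X o).2 % 12 ∧
        (hopData b X o).2 % 12 ≤ 10 then
      match if path = [] then
          if (hopData b X o).2 < 24 then some 0
          else if (hopData b X o).2 < 144 then
            ev (hopData b X o).2 (minus X (hopData b X o).1)
          else none
        else if 12 ≤ (hopData b X o).2 ∧ (hopData b X o).2 < 156 then
          follow ev path (hopData b X o).2 (minus X (hopData b X o).1)
        else none with
      | some z => some (bit (hopData b X o).2 ||| minus z (hopData b X o).1)
      | none => none
    else none

/-- Finds the directions of a jump that wins for Betty at once. -/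
def winPath : ℕ → ℕ → ℕ → Option (List ℕ)
  | 0, _, _ => none
  | fuel + 1, b, X => offsets.findSome? fun o =>
      if (hopData b X o).1 ≠ 0 ∧ 1 ≤ (hopData b X o).2 % 12 ∧ (hopData b X o).2 % 12 ≤ 10 then
        if (hopData b X o).2 < 24 then some [o]
        else if (hopData b X o).2 < 156 then
          (winPath fuel (hopData b X o).2 (minus X (hopData b X o).1)).map (o :: ·)
        else none
      else none

/-- Tries a move of Betty, a placement or a jump, using `ev` for Alfred's replies. -/
def tryMove (ev : ℕ → ℕ → Option ℕ) (b X : ℕ) : ℕ ⊕ List ℕ → Option ℕ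
  | .inl q =>
    if onBoard q = true ∧ q ≠ b ∧ X.testBit q = false then
      match ev b (X ||| bit q) with
      | some z => if z.testBit q then none else some (z ||| bit q)
      | none => none
    else none
  | .inr path => follow ev path b X

/-- Moves for Betty that are worth trying, by the point of the ball. -/
def policy (b : ℕ) : List (ℕ ⊕ List ℕ) :=
  if b = 25 then [.inl 142, .inl 13]
  else if b = 49 then [.inl 37]
  else if b = 90 then [.inl 91]
  else if b = 62 then [.inl 50]
  else if b = 88 ∨ b = 86 then [.inl 75]
  else if b = 116 then [.inl 104]
  else if b = 61 then [.inl 37, .inl 49, .inr [26, 24, 26, 2, 1, 1, 12, 1]]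
  else if b = 85 then [.inl 73]
  else []

/-- Searches for a win of Betty, to move, with at most `n` moves before the winning jump. -/
def betty : ℕ → ℕ → ℕ → Option ℕ
  | 0, b, X =>
    if 24 ≤ b ∧ b < 144 then
      (winPath 5 b X).bind fun path => tryMove (fun _ _ => none) b X (.inr path)
    else none
  | n + 1, b, X =>
    match betty 0 b X with
    | some z => some z
    | none =>
      if 24 ≤ b ∧ b < 144 then
        (policy b).findSome? (tryMove (alfred (betty n) (betty n)) b X)
      else none

lemma winner_point (b : ℕ) (C : Finset (ℤ × ℤ)) (p : Player) :
    winner 12 ⟨point b, C, p⟩ =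
      if 144 ≤ b then some true else if b < 24 then some false else none := by
  have h1 : (12 : ℤ) ≤ (b / 12 : ℕ) ↔ 144 ≤ b := by omega
  have h2 : ((b / 12 : ℕ) : ℤ) ≤ 1 ↔ b < 24 := by omega
  simp only [winner, point, h1, h2]

lemma onBoard_point {l : ℕ} (h1 : 1 ≤ l % 12) (h2 : l % 12 ≤ 10) (h3 : 12 ≤ l) (h4 : l < 156) :
    OnBoard 12 10 (point l) := by
  simp only [OnBoard, point]
  omega

section
variable {ev ev₀ : ℕ → ℕ → Option ℕ} {P : PState → Prop} {b X Z : ℕ} {C : Finset (ℤ × ℤ)}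

lemma jumpZone_landing {fuel : ℕ} (h : jumpZone ev (fuel + 1) b X = some Z)
    (hA : Agrees b X Z C) {o : ℕ} (ho : o ∈ offsets) :
    point (hopData b X o).2 ∉ C ∧
      ((hopData b X o).1 ≠ 0 → 1 ≤ (hopData b X o).2 % 12 → (hopData b X o).2 % 12 ≤ 10 →
        12 ≤ (hopData b X o).2 → (hopData b X o).2 < 144 ∧ ∃ z w,
          (if (hopData b X o).2 < 24 then some 0
            else ev (hopData b X o).2 (minus X (hopData b X o).1)) = some z ∧
          jumpZone ev fuel (hopData b X o).2 (minus X (hopData b X o).1) = some w ∧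
          ∀ i, (minus (z ||| w) (hopData b X o).1).testBit i = true → point i ∉ C) := by
  obtain ⟨x, hx, hxZ⟩ := gather_spec h ho
  split at hx
  · rename_i hcase
    obtain rfl := Option.some.inj hx
    exact ⟨hA.not_mem _ (hxZ _ (by simp [testBit_bit])), by omega⟩
  · split at hx
    · simp at hx
    · split at hx
      · rename_i z w hz hw
        obtain rfl := Option.some.inj hx
        refine ⟨hA.not_mem _ (hxZ _ (by simp [testBit_bit, Nat.testBit_or])),
          fun _ _ _ _ => ⟨by omega, z, w, hz, hw, fun i hi => hA.not_mem _ (hxZ _ ?_)⟩⟩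
        rw [Nat.testBit_or, hi, Bool.or_true]
      · simp at hx

lemma jumpZone_sound (hP : ∀ s, winner 12 s = some false → P s) (hev : Sound false P ev)
    {fuel : ℕ} (h : jumpZone ev fuel b X = some Z) (hA : Agrees b X Z C) {b' : ℤ × ℤ}
    {C' : Finset (ℤ × ℤ)} (hj : Jump 12 10 (point b) C b' C') : P ⟨b', C', false⟩ := by
  induction fuel generalizing b X Z C with
  | zero => simp [jumpZone] at h
  | succ fuel ih =>
    have hland := fun o (ho : o ∈ offsets) => (jumpZone_landing h hA ho).1
    have hmain : ∀ {b₁ C₁}, Hop 10 (point b) C b₁ C₁ → P ⟨b₁, C₁, false⟩ ∧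
        (1 ≤ b₁.2 → Jump 12 10 b₁ C₁ b' C' → P ⟨b', C', false⟩) := by
      intro b₁ C₁ hop
      obtain ⟨o, ho, hL, h1, h10, rfl, rfl⟩ := hopData_of_hop hA hland hop
      obtain ⟨hlC, hl⟩ := jumpZone_landing h hA ho
      by_cases h12 : 12 ≤ (hopData b X o).2
      · obtain ⟨h144, z, w, hz, hw, hzw⟩ := hl hL h1 h10 h12
        have hB := onBoard_point h1 h10 h12 (by omega)
        refine ⟨?_, fun _ hj => ih hw (hA.hop hB hlC fun i hi => hzw i ?_) hj⟩
        · split_ifs at hz with h24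
          · exact hP _ (by rw [winner_point, if_neg (by omega), if_pos h24])
          · refine hev _ _ _ _ hz (hA.hop hB hlC fun i hi => hzw i ?_)
            simp only [testBit_minus, Nat.testBit_or, Bool.and_eq_true] at hi ⊢
            simp [hi]
        · simp only [testBit_minus, Nat.testBit_or, Bool.and_eq_true] at hi ⊢
          simp [hi]
      · refine ⟨hP _ (by rw [winner_point, if_neg (by omega), if_pos (by omega)]), fun h => ?_⟩
        simp only [point] at h
        omega
    cases hj with
    | single hop => exact (hmain hop).1
    | cons hop h1 _ hj => exact (hmain hop).2 h1 hj

lemma alfred_sound (hP : ∀ s, winner 12 s = some false → P s) (hev₀ : Sound false P ev₀)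
    (hev : Sound false P ev) (h : alfred ev₀ ev b X = some Z) (hA : Agrees b X Z C) :
    winner 12 ⟨point b, C, true⟩ = none ∧ (∃ t, MoveRel 12 10 ⟨point b, C, true⟩ t) ∧
      ∀ t, MoveRel 12 10 ⟨point b, C, true⟩ t → P t := by
  unfold alfred at h
  split at h <;> [skip; simp at h]
  rename_i hb
  split at h <;> [skip; simp at h]
  rename_i z₀ zj hz₀ hzj
  split at h <;> [skip; simp at h]
  rename_i zp hzp
  split at h <;> [skip; simp at h]
  rename_i hany
  obtain rfl := Option.some.inj h
  refine ⟨by rw [winner_point, if_neg (by omega), if_neg (by omega)], ?_, ?_⟩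
  · obtain ⟨q, hqB, hq⟩ := List.any_eq_true.1 hany
    simp only [Bool.and_eq_true, Bool.not_eq_true', beq_eq_false_iff_ne] at hq
    refine ⟨⟨point b, insert (point q) C, false⟩, rfl, Or.inl ⟨point q,
      onBoard_iff.1 (List.mem_filter.1 hqB).2, hA.not_mem _ hq.1, fun h => hq.2 ?_, rfl, rfl⟩⟩
    rw [← code_point q, h, code_point]
  · rintro ⟨b', C', p'⟩ ⟨ht, ⟨p, hp, hpC, hpb, hb', hC'⟩ | hj⟩
    · simp only at ht hpC hpb hb' hC'
      subst ht hb' hC'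
      have hpc : point (code p) = p := point_code hp
      have hne : code p ≠ b := fun h => hpb (by rw [← hpc, h])
      have hpz : ∀ {z}, z.testBit (code p) = false → (∀ i, z.testBit i = true →
          (z₀ ||| zj ||| zp).testBit i = true) →
          Agrees b (X ||| bit (code p)) z (insert p C) := by
        intro z hz hzZ
        have := hA.place (q := code p) (by rwa [hpc]) hne hz fun i hi => hA.not_mem _ (hzZ i hi)
        rwa [hpc] at this
      cases hbit : z₀.testBit (code p) with
      | false =>
        have hA' := hpz hbit fun i hi => by simp [Nat.testBit_or, hi]
        refine hev₀ _ _ _ _ hz₀ ⟨hA'.board, hA'.ball, hA'.ball_not_mem, fun i hi => ?_,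
          hA'.not_mem⟩
        exact hA'.mem i (by simp [Nat.testBit_or, hi])
      | true =>
        obtain ⟨x, hx, hxz⟩ := gather_spec hzp (code_mem_boardCodes hp)
        rw [if_pos ⟨hbit, hne⟩] at hx
        split at hx <;> [skip; simp at hx]
        rename_i y hy
        split_ifs at hx with hyp
        obtain rfl := Option.some.inj hx
        exact hev _ _ _ _ hy (hpz (by simpa using hyp) fun i hi => by
          simp [Nat.testBit_or, hxz i hi])
    · obtain rfl : p' = false := ht
      refine jumpZone_sound hP hev hzj (hA.forget fun i hi => hA.not_mem _ ?_) hj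
      simp [Nat.testBit_or, hi]

lemma follow_sound (hP : ∀ s, winner 12 s = some false → P s) (hev : Sound true P ev)
    {path : List ℕ} (h : follow ev path b X = some Z) (hA : Agrees b X Z C) :
    ∃ b' C', Jump 12 10 (point b) C b' C' ∧ P ⟨b', C', true⟩ := by
  induction path generalizing b X Z C with
  | nil => simp [follow] at h
  | cons o path ih =>
    unfold follow at h
    split at h <;> [skip; simp at h]
    rename_i hcond
    obtain ⟨ho, hL, h1, h10⟩ := hcond
    split at h <;> [skip; simp at h]
    rename_i z hz
    obtain rfl := Option.some.inj h
    have hlC : point (hopData b X o).2 ∉ C :=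
      hA.not_mem _ (by simp [testBit_bit, Nat.testBit_or])
    have hzC : ∀ i, (minus z (hopData b X o).1).testBit i = true → point i ∉ C :=
      fun i hi => hA.not_mem _ (by simp [Nat.testBit_or, hi])
    have hop := hop_of_hopData hA ho hlC hL h1 h10
    split_ifs at hz with hpath h24 h144 hrow
    · exact ⟨_, _, .single hop, hP _ (by rw [winner_point, if_neg (by omega), if_pos h24])⟩
    · exact ⟨_, _, .single hop, hev _ _ _ _ hz
        (hA.hop (onBoard_point h1 h10 (by omega) (by omega)) hlC hzC)⟩
    · obtain ⟨b', C', hj, hp⟩ := ih hz (hA.hop (onBoard_point h1 h10 hrow.1 hrow.2) hlC hzC)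
      refine ⟨b', C', .cons hop ?_ ?_ hj, hp⟩ <;> simp only [point] <;> omega

lemma tryMove_sound (hP : ∀ s, winner 12 s = some false → P s) (hev : Sound true P ev)
    {m : ℕ ⊕ List ℕ} (h : tryMove ev b X m = some Z) (hA : Agrees b X Z C) :
    ∃ t, MoveRel 12 10 ⟨point b, C, false⟩ t ∧ P t := by
  cases m with
  | inl q =>
    simp only [tryMove] at h
    split at h <;> [skip; simp at h]
    rename_i hcond
    obtain ⟨hq, hqb, -⟩ := hcond
    split at h <;> [skip; simp at h]
    rename_i z hz
    split_ifs at h with hzq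
    obtain rfl := Option.some.inj h
    have hqB := onBoard_iff.1 hq
    refine ⟨⟨point b, insert (point q) C, true⟩, ⟨rfl, Or.inl ⟨point q, hqB,
      hA.not_mem _ (by simp [Nat.testBit_or, testBit_bit]), fun h => hqb ?_, rfl, rfl⟩⟩, ?_⟩
    · rw [← code_point q, h, code_point]
    · exact hev _ _ _ _ hz (hA.place hqB hqb (by simpa using hzq) fun i hi =>
        hA.not_mem _ (by simp [Nat.testBit_or, hi]))
  | inr path =>
    obtain ⟨b', C', hj, hp⟩ := follow_sound hP hev h hA
    exact ⟨⟨b', C', true⟩, ⟨rfl, Or.inr hj⟩, hp⟩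

end

lemma WinsIn.of_move {k b : ℕ} {C : Finset (ℤ × ℤ)} (hb : 24 ≤ b ∧ b < 144)
    (h : ∃ t, MoveRel 12 10 ⟨point b, C, false⟩ t ∧ WinsIn 12 10 false k t) :
    WinsIn 12 10 false (k + 1) ⟨point b, C, false⟩ := by
  obtain ⟨t, hm, ht⟩ := h
  exact Or.inr ⟨by rw [winner_point, if_neg (by omega), if_neg (by omega)], ⟨t, hm⟩,
    by simpa using ⟨t, hm, ht⟩⟩

lemma betty_zero_sound : Sound false (WinsIn 12 10 false 1) (betty 0) := by
  intro b X Z C h hA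
  unfold betty at h
  split_ifs at h with hb
  obtain ⟨path, -, hpath⟩ := Option.bind_eq_some_iff.1 h
  exact WinsIn.of_move hb (tryMove_sound (fun s hs => hs) (sound_none _ _) hpath hA)

lemma betty_sound (n : ℕ) : Sound false (WinsIn 12 10 false (2 * n + 1)) (betty n) := by
  induction n with
  | zero => exact betty_zero_sound
  | succ n ih =>
    intro b X Z C h hA
    unfold betty at h
    split at h
    · rename_i z hz
      obtain rfl := Option.some.inj h
      exact WinsIn.mono (by omega) (betty_zero_sound _ _ _ _ hz hA)
    · split_ifs at h with hb
      obtain ⟨m, -, hm⟩ := List.exists_of_findSome?_eq_some h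
      refine WinsIn.of_move hb (k := 2 * n + 2)
        (tryMove_sound (fun s hs => WinsIn.of_winner hs _) ?_ hm hA)
      intro b X Z C h hA
      obtain ⟨hw, hex, hall⟩ := alfred_sound (fun s hs => WinsIn.of_winner hs _) ih ih h hA
      exact Or.inr ⟨hw, hex, by simpa using hall⟩

/-! ### The cycle of positions -/

/-- The mask of a list of codes. -/
def maskOf : List ℕ → ℕ
  | [] => 0
  | i :: l => maskOf l ||| bit i

lemma testBit_maskOf (l : List ℕ) (i : ℕ) : (maskOf l).testBit i = true ↔ i ∈ l := by
  induction l with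
  | nil => simp [maskOf]
  | cons j l ih =>
    rw [maskOf, Nat.testBit_or, Bool.or_eq_true, ih, testBit_bit, decide_eq_true_eq, List.mem_cons,
      or_comm, eq_comm]

/-- The position with the given codes of ball and chaps. -/
def position (b : ℕ) (l : List ℕ) (p : Player) : PState := ⟨point b, (l.map point).toFinset, p⟩

/-- A search that excepts the position with ball `b₀` and chaps `l`. -/
def except (b₀ : ℕ) (l : List ℕ) (ev : ℕ → ℕ → Option ℕ) (b X : ℕ) : Option ℕ :=
  if b = b₀ ∧ X = maskOf l then some (minus (maskOf boardCodes) X) else ev b X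

lemma except_sound {P : PState → Prop} {ev : ℕ → ℕ → Option ℕ} (hev : Sound false P ev) (b₀ : ℕ)
    (l : List ℕ) : Sound false (fun s => P s ∨ s = position b₀ l false) (except b₀ l ev) := by
  intro b X Z C h hA
  unfold except at h
  split_ifs at h with hcond
  · obtain ⟨rfl, rfl⟩ := hcond
    obtain rfl := Option.some.inj h
    refine Or.inr ?_
    rw [position, PState.mk.injEq]
    refine ⟨rfl, Finset.ext fun p => ?_, rfl⟩
    simp only [List.mem_toFinset, List.mem_map]
    constructor
    · intro hp
      refine ⟨code p, ?_, point_code (hA.board p hp)⟩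
      by_contra hl
      refine hA.not_mem (code p) ?_ (by rwa [point_code (hA.board p hp)])
      rw [← testBit_maskOf, Bool.not_eq_true] at hl
      rw [testBit_minus, hl, (testBit_maskOf _ _).2 (code_mem_boardCodes (hA.board p hp))]
      rfl
    · rintro ⟨i, hi, rfl⟩
      exact hA.mem i ((testBit_maskOf _ _).2 hi)
  · exact Or.inl (hev _ _ _ _ h hA)

/-- The codes of the chaps of `P0` and of the first `k` points of the diagonal. -/
def chapCodes (k : ℕ) : List ℕ :=
  [15, 27, 63, 87, 111, 123, 135, 147, 76, 53, 137, 149, 18, 30, 114, 91, 20, 32, 44, 56, 80, 104,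
    140, 152] ++ [38, 51, 64, 77, 90, 103, 116, 129].take k

/-- The code of the ball in the `k`-th position of the cycle with Alfred to move. -/
def rootBall (k : ℕ) : ℕ := if k % 2 = 0 then 25 else 142

/-- The codes of the chaps in the `k`-th position of the cycle with Alfred to move. -/
def rootCodes (k : ℕ) : List ℕ :=
  if k % 2 = 0 then chapCodes k else (chapCodes k).map (167 - ·)

/-- The `k`-th position of the cycle with Alfred to move. -/
def root (k : ℕ) : PState := position (rootBall k) (rootCodes k) true

/-- The code of the ball in the `k`-th position of the cycle with Betty to move. -/
def replyBall (k : ℕ) : ℕ := 167 - rootBall k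

/-- The codes of the chaps in the `k`-th position of the cycle with Betty to move. -/
def replyCodes (k : ℕ) : List ℕ := (rootCodes k).map (167 - ·)

/-- The `k`-th position of the cycle with Betty to move. -/
def reply (k : ℕ) : PState := position (replyBall k) (replyCodes k) false

/-- The search for the claim that all moves of Alfred from `root k` but one lose. -/
def rootSearch (k : ℕ) : Option ℕ :=
  alfred (betty 5) (except (replyBall ((k + 1) % 9)) (replyCodes ((k + 1) % 9)) (betty 5))
    (rootBall k) (maskOf (rootCodes k))

lemma rootSearch_disjoint :
    ∀ k < 9, (rootSearch k).all (fun z => z &&& maskOf (rootCodes k) == 0) = true ∧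
      (rootSearch k).isSome = true := by
  decide +kernel

lemma rootCodes_onBoard :
    ∀ k < 9, onBoard (rootBall k) = true ∧ rootBall k ∉ rootCodes k ∧
      ∀ i ∈ rootCodes k, onBoard i = true := by
  decide +kernel

lemma root_moves {k : ℕ} (hk : k < 9) {t : PState} (ht : MoveRel 12 10 (root k) t) :
    WinsIn 12 10 false 11 t ∨ t = reply ((k + 1) % 9) := by
  obtain ⟨hdis, hsome⟩ := rootSearch_disjoint k hk
  obtain ⟨z, hz⟩ := Option.isSome_iff_exists.1 hsome
  rw [hz, Option.all_some, beq_iff_eq] at hdis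
  obtain ⟨hb, hbl, hl⟩ := rootCodes_onBoard k hk
  have hmem : ∀ i, point i ∈ ((rootCodes k).map point).toFinset → i ∈ rootCodes k := by
    intro i hi
    obtain ⟨j, hj, hji⟩ := List.mem_map.1 (List.mem_toFinset.1 hi)
    rwa [← code_point i, ← hji, code_point]
  have hA : Agrees (rootBall k) (maskOf (rootCodes k)) z ((rootCodes k).map point).toFinset := by
    refine ⟨fun p hp => ?_, onBoard_iff.1 hb, fun h => hbl (hmem _ h), fun i hi => ?_,
      fun i hi hiC => ?_⟩
    · obtain ⟨j, hj, rfl⟩ := List.mem_map.1 (List.mem_toFinset.1 hp)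
      exact onBoard_iff.1 (hl j hj)
    · exact List.mem_toFinset.2 (List.mem_map_of_mem ((testBit_maskOf _ _).1 hi))
    · have := congrArg (Nat.testBit · i) hdis
      simp [Nat.testBit_and, hi, (testBit_maskOf _ _).2 (hmem i hiC)] at this
  exact (alfred_sound (fun s hs => Or.inl (WinsIn.of_winner hs _))
    ((betty_sound 5).imp fun _ => Or.inl) (except_sound (betty_sound 5) _ _) hz hA).2.2 t ht

lemma reply_eq : ∀ k < 9, reply k = turnState (root k) := by decide +kernel

lemma root_eight : root 8 = P8 := by decide +kernel

lemma reply_zero : reply 0 = P8jump := by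
  rw [reply, position, P8jump, PState.mk.injEq]
  exact ⟨by decide +kernel, by decide +kernel, rfl⟩

lemma winner_cycle : ∀ k < 9, winner 12 (root k) = none ∧ winner 12 (reply k) = none := by
  decide +kernel

lemma P8_hop : Hop 10 (1, 2) P8.chaps (10, 11) P0chaps := by
  refine ⟨(1, 1), by decide, 8, by norm_num, ?_, by decide, by decide, by decide, by decide,
    by decide +kernel⟩
  intro i h1 h8
  interval_cases i <;> decide

lemma P8_jump : MoveRel 12 10 P8 P8jump := ⟨rfl, Or.inr (.single P8_hop)⟩

lemma root_placement : ∀ k < 8, ∃ q ∈ boardCodes, q ∉ rootCodes k ∧ q ≠ rootBall k ∧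
    replyBall (k + 1) = rootBall k ∧
      ((replyCodes (k + 1)).map point).toFinset =
        insert (point q) ((rootCodes k).map point).toFinset := by
  decide +kernel

lemma root_reply {k : ℕ} (hk : k < 9) : MoveRel 12 10 (root k) (reply ((k + 1) % 9)) := by
  obtain rfl | hk8 : k = 8 ∨ k < 8 := by omega
  · rw [root_eight]
    exact reply_zero ▸ P8_jump
  · obtain ⟨q, hq, hql, hqb, hb, hC⟩ := root_placement k hk8
    rw [Nat.mod_eq_of_lt (by omega)]
    refine ⟨rfl, Or.inl ⟨point q, onBoard_iff.1 (List.mem_filter.1 hq).2, fun h => hql ?_,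
      fun h => hqb ?_, congrArg point hb, hC⟩⟩
    · obtain ⟨j, hj, hjq⟩ := List.mem_map.1 (List.mem_toFinset.1 h)
      rwa [← code_point q, ← hjq, code_point]
    · rw [← code_point q, h]
      exact code_point _

lemma WinsIn.winner_eq {m n : ℤ} {p q : Player} {k : ℕ} {s : PState} (h : WinsIn m n p k s)
    (hs : winner m s = some q) : q = p := by
  induction k with
  | zero => exact Option.some.inj (hs.symm.trans h)
  | succ k ih =>
    rcases h with h | ⟨h, -⟩
    · exact ih h
    · simp [hs] at h

lemma WinsIn.next {m n : ℤ} {p : Player} {k : ℕ} {s : PState} (h : WinsIn m n p k s)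
    (hs : winner m s = none) :
    if s.turn = p then ∃ t, MoveRel m n s t ∧ ∃ l, WinsIn m n p l t
    else ∀ t, MoveRel m n s t → ∃ l, WinsIn m n p l t := by
  induction k with
  | zero => simp [WinsIn, hs] at h
  | succ k ih =>
    rcases h with h | ⟨-, -, h⟩
    · exact ih h
    · split_ifs at h ⊢
      · obtain ⟨t, hm, ht⟩ := h
        exact ⟨t, hm, k, ht⟩
      · exact fun t hm => ⟨k, h t hm⟩

lemma P8jump_not_winsFrom : ¬ WinsFrom 12 10 false P8jump := by
  refine not_winsFrom_of_invariant
    {s | (∃ l, WinsIn 12 10 true l s) ∨ ∃ k < 9, s = root k ∨ s = reply k} ?_ ?_ ?_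
    (Or.inr ⟨0, by norm_num, Or.inr reply_zero.symm⟩)
  · rintro s (⟨l, hl⟩ | ⟨k, hk, rfl | rfl⟩) hw
    · simpa using hl.winner_eq hw
    · simp [(winner_cycle k hk).1] at hw
    · simp [(winner_cycle k hk).2] at hw
  · rintro s (⟨l, hl⟩ | ⟨k, hk, rfl | rfl⟩) hw hturn t ht
    · have := hl.next hw
      rw [if_neg (by simp [hturn])] at this
      exact Or.inl (this t ht)
    · simp [root, position] at hturn
    · rw [reply_eq k hk, moveRel_turn_iff] at ht
      rcases root_moves hk ht with h | h
      · have := h.turn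
        rw [turnState_involutive t] at this
        exact Or.inl ⟨11, this⟩
      · have hk' : (k + 1) % 9 < 9 := Nat.mod_lt _ (by norm_num)
        rw [reply_eq _ hk'] at h
        exact Or.inr ⟨_, hk', Or.inl (turnState_involutive.injective h)⟩
  · rintro s (⟨l, hl⟩ | ⟨k, hk, rfl | rfl⟩) hw hturn -
    · have := hl.next hw
      rw [if_pos (by simpa using hturn)] at this
      obtain ⟨t, hm, ht⟩ := this
      exact ⟨t, Or.inl ht, hm⟩
    · exact ⟨_, Or.inr ⟨_, Nat.mod_lt _ (by norm_num), Or.inr rfl⟩, root_reply hk⟩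
    · simp [reply, position] at hturn

/-- From `P8`, the jump consisting of the single northeast hop to j11 is
Alfred's unique non-losing move: the hop (and hence the jump, and hence the
move to `P8jump`) is legal; after it Betty has no winning strategy from the
resulting position; and every other legal move of Alfred from `P8` leads to a
position from which Betty has a winning strategy. -/
theorem P8_unique_nonlosing :
    Hop 10 (1, 2) P8.chaps (10, 11) P0chaps ∧
    Jump 12 10 (1, 2) P8.chaps (10, 11) P0chaps ∧
    MoveRel 12 10 P8 P8jump ∧
    ¬ WinsFrom 12 10 false P8jump ∧
    ∀ t, MoveRel 12 10 P8 t → t ≠ P8jump → WinsFrom 12 10 false t := by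
  refine ⟨P8_hop, .single P8_hop, P8_jump, P8jump_not_winsFrom, fun t ht hne => ?_⟩
  rw [← root_eight] at ht
  exact ((root_moves (by norm_num) ht).resolve_right fun h => hne (h.trans reply_zero)).winsFrom
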